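/- Let p be a probability mass function on Fin M with p j > 0 for every j, let C : Fin M → ℝ, and let α ∈ (0,1). Then the supremum of ∑ j, q j · C j over all probability mass functions q on Fin M with d_TV(p,q) ≤ α equals the minimum, over m, z ∈ ℝ and s : Fin M → ℝ satisfying m ≥ C j, s j ≥ 0, and s j + z ≥ C j for all j, of α · m + (1 − α) · ∑ j, p j · ( z + s j / (1 − α) ); moreover this minimum is attained. (This is the core reformulation in Lemma 3, expressing the TVD risk objective as a finite convex minimization.) -/

import Mathlib

open Finset

section TotalVariationRisk

variable {ι : Type*} [Fintype ι]

/-- Weak duality: every expectation over the total variation ball is bounded by every value of the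
dual objective. -/
theorem sum_mul_le_of_tvd_le {p q C s : ι → ℝ} {α m z : ℝ} (hα1 : α ≤ 1)
    (hp0 : ∀ j, 0 ≤ p j) (hp1 : ∑ j, p j = 1) (hq0 : ∀ j, 0 ≤ q j) (hq1 : ∑ j, q j = 1)
    (hpq : (1 / 2) * ∑ j, |p j - q j| ≤ α)
    (hm : ∀ j, C j ≤ m) (hs : ∀ j, 0 ≤ s j) (hsz : ∀ j, C j ≤ s j + z) :
    ∑ j, q j * C j ≤ α * m + (1 - α) * z + ∑ j, p j * s j := by
  have hps : 0 ≤ ∑ j, p j * s j := sum_nonneg fun j _ => mul_nonneg (hp0 j) (hs j)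
  rcases le_total m z with hmz | hzm
  · have h : ∑ j, q j * C j ≤ ∑ j, q j * m :=
      sum_le_sum fun j _ => mul_le_mul_of_nonneg_left (hm j) (hq0 j)
    rw [← sum_mul, hq1] at h
    nlinarith
  · have h : ∑ j, q j * C j ≤
        ∑ j, (q j * z + p j * s j + (1 / 2 * (|p j - q j| + q j - p j)) * (m - z)) := by
      refine sum_le_sum fun j _ => ?_
      rcases le_total (p j) (q j) with h | h
      · rw [abs_of_nonpos (by linarith)]
        nlinarith [mul_le_mul_of_nonneg_left (hsz j) (hp0 j),
          mul_le_mul_of_nonneg_left (hm j) (sub_nonneg.2 h)]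
      · rw [abs_of_nonneg (by linarith)]
        nlinarith [mul_le_mul_of_nonneg_left (hsz j) (hq0 j),
          mul_le_mul_of_nonneg_right h (hs j)]
    rw [sum_add_distrib, sum_add_distrib, ← sum_mul, ← sum_mul, ← mul_sum, sum_sub_distrib,
      sum_add_distrib, hp1, hq1] at h
    nlinarith [mul_le_mul_of_nonneg_right hpq (sub_nonneg.2 hzm)]

/-- Existence of an `α`-quantile of `C` under the weights `p`, attained as a value of `C`. -/
theorem exists_quantile [Nonempty ι] {p : ι → ℝ} (C : ι → ℝ) {α : ℝ}
    (hα0 : 0 ≤ α) (hα1 : α ≤ ∑ j, p j) :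
    ∃ k, ∑ j with C j < C k, p j ≤ α ∧ α ≤ ∑ j with C j ≤ C k, p j := by
  obtain ⟨n, hn⟩ := Finite.exists_max C
  obtain ⟨k, hk, hmin⟩ := exists_min_image {k | α ≤ ∑ j with C j ≤ C k, p j} C
    ⟨n, by simpa [hn] using hα1⟩
  refine ⟨k, ?_, by simpa using hk⟩
  rcases ({j | C j < C k} : Finset ι).eq_empty_or_nonempty with he | hne
  · simpa [he] using hα0
  · obtain ⟨i, hi, hmax⟩ := exists_max_image _ C hne
    simp only [mem_filter, mem_univ, true_and] at hi hmax hmin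
    rw [filter_congr fun j _ => ⟨hmax j, fun h => h.trans_lt hi⟩]
    by_contra! hlt
    exact (hmin i hlt.le).not_gt hi

/-- Retaining only the upper part of the distribution: there are weights `r ≤ p` of total mass
`1 - α` concentrated on the largest values of `C`. -/
theorem exists_upper_part [Nonempty ι] {p : ι → ℝ} (C : ι → ℝ) {α : ℝ}
    (hα0 : 0 ≤ α) (hα1 : α ≤ 1) (hp0 : ∀ j, 0 < p j) (hp1 : ∑ j, p j = 1) :
    ∃ (z : ℝ) (r : ι → ℝ), (∀ j, 0 ≤ r j) ∧ (∀ j, r j ≤ p j) ∧ ∑ j, r j = 1 - α ∧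
      ∀ j, r j * (C j - z) = p j * max (C j - z) 0 := by
  obtain ⟨k, hlt, hle⟩ := exists_quantile C hα0 (hα1.trans hp1.ge)
  rw [sum_filter] at hlt hle
  set z := C k
  set B := ∑ j, if C j = z then p j else 0 with hB
  set A := ∑ j, if z < C j then p j else 0 with hA
  have hBpos : 0 < B := by
    refine sum_pos' (fun j _ => ?_) ⟨k, mem_univ k, by simpa [z] using hp0 k⟩
    split_ifs
    exacts [(hp0 j).le, le_rfl]
  have h1 : A + ∑ j, (if C j ≤ z then p j else 0) = 1 := by
    rw [hA, ← sum_add_distrib, ← hp1]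
    refine sum_congr rfl fun j _ => ?_
    split_ifs <;> grind
  have h2 : A + B + ∑ j, (if C j < z then p j else 0) = 1 := by
    rw [hA, hB, ← sum_add_distrib, ← sum_add_distrib, ← hp1]
    refine sum_congr rfl fun j _ => ?_
    split_ifs <;> grind
  set θ := (1 - α - A) / B with hθ
  have hθ0 : 0 ≤ θ := div_nonneg (by linarith) hBpos.le
  have hθ1 : θ ≤ 1 := (div_le_one hBpos).2 (by linarith)
  refine ⟨z, fun j => (if z < C j then p j else 0) + θ * (if C j = z then p j else 0),
    fun j => ?_, fun j => ?_, ?_, fun j => ?_⟩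
  · have := (hp0 j).le
    dsimp only
    split_ifs <;> positivity
  · have := (hp0 j).le
    dsimp only
    split_ifs <;> nlinarith
  · rw [sum_add_distrib, ← mul_sum, ← hA, ← hB, hθ, div_mul_cancel₀ _ hBpos.ne']
    ring
  · rcases lt_trichotomy (C j) z with h | h | h
    · simp [h.not_gt, h.ne, max_eq_right (sub_nonpos.2 h.le)]
    · simp [h]
    · simp [h, h.ne', max_eq_left (sub_nonneg.2 h.le)]

/-- Moving mass `α` from the weights `p - r` onto a single point `n` stays in the total variation
ball of radius `α`. -/
theorem tvd_add_single_le [DecidableEq ι] {p r : ι → ℝ} {α : ℝ} (hα0 : 0 ≤ α)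
    (hp1 : ∑ j, p j = 1) (hrp : ∀ j, r j ≤ p j) (hr1 : ∑ j, r j = 1 - α) (n : ι) :
    (1 / 2) * ∑ j, |p j - (r j + if j = n then α else 0)| ≤ α := by
  have h : ∑ j, |p j - (r j + if j = n then α else 0)| ≤
      ∑ j, (p j - r j + if j = n then α else 0) := by
    refine sum_le_sum fun j _ => ?_
    have := hrp j
    rw [abs_le]
    split_ifs <;> constructor <;> linarith
  rw [sum_add_distrib, sum_sub_distrib, hp1, hr1, sum_ite_eq' univ n, if_pos (mem_univ n)] at h
  linarith

end TotalVariationRisk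

/-- core reformulation in Lemma 3 — the TVD risk objective equals a
finite convex minimization, with the minimum attained. -/
theorem tvd_risk_min_representation (M : ℕ) (p C : Fin M → ℝ) (α : ℝ)
    (hα : α ∈ Set.Ioo (0 : ℝ) 1)
    (hp0 : ∀ j, 0 < p j) (hp1 : ∑ j, p j = 1) :
    IsLeast {v : ℝ | ∃ (m z : ℝ) (s : Fin M → ℝ),
        (∀ j, C j ≤ m) ∧ (∀ j, 0 ≤ s j) ∧ (∀ j, C j ≤ s j + z) ∧
        v = α * m + (1 - α) * ∑ j, p j * (z + s j / (1 - α))}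
      (sSup {v : ℝ | ∃ q : Fin M → ℝ, (∀ j, 0 ≤ q j) ∧ (∑ j, q j = 1) ∧
        (1 / 2) * ∑ j, |p j - q j| ≤ α ∧ v = ∑ j, q j * C j}) := by
  obtain ⟨hα0, hα1⟩ := hα
  have hobj (m z : ℝ) (s : Fin M → ℝ) : α * m + (1 - α) * ∑ j, p j * (z + s j / (1 - α)) =
      α * m + (1 - α) * z + ∑ j, p j * s j := by
    have h : (1 - α) ≠ 0 := by linarith
    simp_rw [mul_add, sum_add_distrib, ← sum_mul, hp1, mul_add, mul_sum]
    rw [one_mul, ← add_assoc]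
    congr 1
    refine sum_congr rfl fun j _ => ?_
    field_simp
  simp only [hobj]
  have : Nonempty (Fin M) := by
    by_contra h
    rw [not_nonempty_iff] at h
    simp at hp1
  obtain ⟨n, hn⟩ := Finite.exists_max C
  obtain ⟨z, r, hr0, hrp, hr1, hrC⟩ := exists_upper_part C hα0.le hα1.le hp0 hp1
  have hweak {q : Fin M → ℝ} {m z : ℝ} {s : Fin M → ℝ} :=
    sum_mul_le_of_tvd_le (q := q) (C := C) (s := s) (m := m) (z := z) hα1.le
      (fun j => (hp0 j).le) hp1
  have hs0 (j) : 0 ≤ max (C j - z) 0 := le_max_right _ _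
  have hsz (j) : C j ≤ max (C j - z) 0 + z := by linarith [le_max_left (C j - z) 0]
  set q : Fin M → ℝ := fun j => r j + if j = n then α else 0 with hq
  have hq0 (j) : 0 ≤ q j := add_nonneg (hr0 j) (by split_ifs <;> linarith)
  have hq1 : ∑ j, q j = 1 := by simp [hq, sum_add_distrib, hr1]
  have hpq : (1 / 2) * ∑ j, |p j - q j| ≤ α := tvd_add_single_le hα0.le hp1 hrp hr1 n
  have hval : α * C n + (1 - α) * z + ∑ j, p j * max (C j - z) 0 = ∑ j, q j * C j := by
    simp only [← hrC, hq, add_mul, mul_sub, sum_add_distrib, sum_sub_distrib, ← sum_mul, hr1,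
      ite_mul, zero_mul, sum_ite_eq', mem_univ, if_true]
    ring
  have hsup : IsGreatest {v : ℝ | ∃ q : Fin M → ℝ, (∀ j, 0 ≤ q j) ∧ (∑ j, q j = 1) ∧
      (1 / 2) * ∑ j, |p j - q j| ≤ α ∧ v = ∑ j, q j * C j} (∑ j, q j * C j) := by
    refine ⟨⟨q, hq0, hq1, hpq, rfl⟩, ?_⟩
    rintro _ ⟨q', hq0', hq1', hpq', rfl⟩
    exact hval ▸ hweak hq0' hq1' hpq' hn hs0 hsz
  rw [hsup.csSup_eq]
  refine ⟨⟨C n, z, _, hn, hs0, hsz, hval.symm⟩, ?_⟩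
  rintro _ ⟨m, z', s, hm, hs, hsz', rfl⟩
  exact hweak hq0 hq1 hpq hm hs hsz'
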